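/- Let 0 < p, q < ∞ and α > -2. For every ε > 0 there exists 0 < ρ < 1 such that for all a ∈ 𝔻 the function f_a(z) = (1-|a|²)^{γ - (α+2)/p - 1/q} / (1 - conj(a)·z)^γ, where γ > max{(α+2)/p + 1/q, (λ + 2α + 4)/p} for some fixed λ > max{1, p/q}, satisfies ‖f_a · χ_{𝔻∖Δ(a,ρ)}‖_{T_p^q(α)} ≤ ε, while C'' ≤ ‖f_a‖_{T_p^q(α)} ≤ C' for absolute constants C', C'' > 0 independent of a. -/

import Mathlib

open Complex MeasureTheory Real Set Metric ComplexConjugate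

/-- Non-tangential region `Γ_ζ(η) = {z ∈ 𝔻 : |z-η| < ζ(1-|z|²)}`. -/
def ntReg (ζ : ℝ) (η : ℂ) : Set ℂ :=
  {z ∈ Metric.ball (0:ℂ) 1 | ‖z - η‖ < ζ * (1 - ‖z‖^2)}

/-- Pseudo-hyperbolic disk `Δ(a,r)`. -/
def pDisk (a : ℂ) (r : ℝ) : Set ℂ :=
  {z ∈ Metric.ball (0:ℂ) 1 | ‖(a - z) / (1 - conj a * z)‖ < r}

/-- The tent-space quasinorm `‖f‖_{T_p^q(α)}` with aperture `ζ`. -/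
noncomputable def tnorm (p q α ζ : ℝ) (f : ℂ → ℂ) : ℝ :=
  (∫ θ in (0:ℝ)..(2*Real.pi),
    (∫ z in ntReg ζ (Complex.exp (θ * Complex.I)),
        ‖f z‖ ^ p * (1 - ‖z‖^2) ^ α) ^ (q/p)) ^ (1/q)


lemma aux_H_int (α m : ℝ) (hα : -2 < α) (hm : α + 2 < m) :
    Integrable (fun u : ℂ => ‖u‖ ^ α * (1 + ‖u‖) ^ (-m)) := by
  rw [integrable_fun_norm_addHaar (volume : Measure ℂ)
    (f := fun y : ℝ => y ^ α * (1 + y) ^ (-m))]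
  have hm0 : 0 < m := by linarith
  rw [← Set.Ioc_union_Ioi_eq_Ioi (zero_le_one' ℝ)]
  simp only [Complex.finrank_real_complex, smul_eq_mul]
  have hmeas : Measurable (fun y : ℝ => y ^ (2-1) * (y ^ α * (1 + y) ^ (-m))) := by fun_prop
  refine IntegrableOn.union ?_ ?_
  · have h1 : IntegrableOn (fun y : ℝ => y ^ (α+1)) (Set.Ioc 0 1) :=
      (intervalIntegrable_iff_integrableOn_Ioc_of_le zero_le_one).1
        (intervalIntegral.intervalIntegrable_rpow' (by linarith))
    refine Integrable.mono' h1 hmeas.aestronglyMeasurable ?_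
    refine (ae_restrict_iff' measurableSet_Ioc).2 (Filter.Eventually.of_forall ?_)
    intro y hy
    have hy0 : 0 < y := hy.1
    rw [Real.norm_of_nonneg (by positivity)]
    have : (1 + y) ^ (-m) ≤ 1 :=
      Real.rpow_le_one_of_one_le_of_nonpos (by linarith) (by linarith)
    rw [Real.rpow_add hy0, Real.rpow_one]
    have h3 : 0 < y ^ α := by positivity
    simp only [Nat.add_one_sub_one, pow_one]
    nlinarith [mul_le_mul_of_nonneg_left this (mul_pos hy0 h3).le]
  · have h1 : IntegrableOn (fun y : ℝ => y ^ (α+1-m)) (Set.Ioi 1) :=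
      integrableOn_Ioi_rpow_of_lt (by linarith) one_pos
    refine Integrable.mono' h1 hmeas.aestronglyMeasurable ?_
    refine (ae_restrict_iff' measurableSet_Ioi).2 (Filter.Eventually.of_forall ?_)
    intro y hy
    have hy0 : 0 < y := lt_trans one_pos hy
    rw [Real.norm_of_nonneg (by positivity)]
    have : (1 + y) ^ (-m) ≤ y ^ (-m) :=
      Real.rpow_le_rpow_of_nonpos hy0 (by linarith) (by linarith)
    rw [sub_eq_add_neg, Real.rpow_add hy0, Real.rpow_add hy0, Real.rpow_one]
    have h3 : 0 < y ^ α := by positivity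
    simp only [Nat.add_one_sub_one, pow_one]
    nlinarith [mul_le_mul_of_nonneg_left this (mul_pos hy0 h3).le]

lemma aux_scale2 (α m : ℝ) (hα : -2 < α) (hm : α + 2 < m) (D : ℝ) (hD : 0 < D) (η : ℂ) :
    Integrable (fun z : ℂ => ‖z - η‖ ^ α * (D + ‖z - η‖) ^ (-m)) ∧
    ∫ z : ℂ, ‖z - η‖ ^ α * (D + ‖z - η‖) ^ (-m) =
      D ^ (α + 2 - m) * ∫ u : ℂ, ‖u‖ ^ α * (1 + ‖u‖) ^ (-m) := by
  have key : ∀ w : ℂ, ‖w‖ ^ α * (D + ‖w‖) ^ (-m) =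
      D ^ (α - m) * (‖D⁻¹ • w‖ ^ α * (1 + ‖D⁻¹ • w‖) ^ (-m)) := by
    intro w
    have e1 : ‖w‖ = D * ‖D⁻¹ • w‖ := by
      rw [norm_smul, norm_inv, Real.norm_of_nonneg hD.le]; field_simp
    set r := ‖D⁻¹ • w‖
    have hr : 0 ≤ r := norm_nonneg _
    rw [e1, show D + D * r = D * (1 + r) by ring, Real.mul_rpow hD.le hr,
      Real.mul_rpow hD.le (by positivity), sub_eq_add_neg, Real.rpow_add hD]
    ring
  have hI := aux_H_int α m hα hm
  have hI2 := (hI.comp_smul (inv_ne_zero hD.ne')).const_mul (D ^ (α - m))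
  constructor
  · have := hI2.comp_sub_right η
    refine this.congr (Filter.Eventually.of_forall fun z => ?_)
    exact (key (z - η)).symm
  · rw [integral_sub_right_eq_self (fun z : ℂ => ‖z‖ ^ α * (D + ‖z‖) ^ (-m)) η]
    simp_rw [key]
    rw [integral_const_mul, Measure.integral_comp_smul volume
      (fun u : ℂ => ‖u‖ ^ α * (1 + ‖u‖) ^ (-m)) D⁻¹, Complex.finrank_real_complex, smul_eq_mul,
      ← mul_assoc]
    congr 1
    rw [abs_of_pos (by positivity), show α + 2 - m = (α - m) + (2:ℕ) by push_cast; ring,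
      Real.rpow_add hD, Real.rpow_natCast]
    simp

lemma aux_scale1 (k : ℝ) (hk : 1 < k) (t : ℝ) (ht : 0 < t) (φ : ℝ) :
    Integrable (fun x : ℝ => (t + |x - φ|) ^ (-k)) ∧
    ∫ x : ℝ, (t + |x - φ|) ^ (-k) = t ^ (1 - k) * ∫ x : ℝ, (1 + |x|) ^ (-k) := by
  have key : ∀ w : ℝ, (t + |w|) ^ (-k) = t ^ (-k) * (1 + |t⁻¹ * w|) ^ (-k) := by
    intro w
    have e1 : |w| = t * |t⁻¹ * w| := by
      rw [abs_mul, abs_inv, abs_of_pos ht]; field_simp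
    set r := |t⁻¹ * w|
    have hr : 0 ≤ r := abs_nonneg _
    rw [e1, show t + t * r = t * (1 + r) by ring, Real.mul_rpow ht.le (by positivity)]
  have hI : Integrable (fun x : ℝ => (1 + |x|) ^ (-k)) := by
    have := integrable_one_add_norm (E := ℝ) (μ := volume) (r := k) (by simpa using hk)
    simpa using this
  have hI2 := (hI.comp_mul_left' (inv_ne_zero ht.ne')).const_mul (t ^ (-k))
  constructor
  · have := hI2.comp_sub_right φ
    refine this.congr (Filter.Eventually.of_forall fun z => ?_)
    exact (key (z - φ)).symm
  · rw [integral_sub_right_eq_self (fun z : ℝ => (t + |z|) ^ (-k)) φ]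
    simp_rw [key]
    rw [integral_const_mul, Measure.integral_comp_mul_left
      (fun u : ℝ => (1 + |u|) ^ (-k)) t⁻¹, smul_eq_mul, ← mul_assoc]
    congr 1
    rw [abs_of_pos (by positivity), show 1 - k = (-k) + 1 by ring,
      Real.rpow_add ht, Real.rpow_one]
    simp

lemma aux_pos (a z : ℂ) (ha : ‖a‖ < 1) (hz : ‖z‖ ≤ 1) :
    1 - ‖z‖ ≤ ‖1 - conj a * z‖ ∧ 1 - ‖a‖ ≤ ‖1 - conj a * z‖ := by
  have h1 : 1 - ‖a‖ * ‖z‖ ≤ ‖1 - conj a * z‖ := by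
    have := norm_sub_norm_le (1:ℂ) (conj a * z)
    simpa using this
  have := norm_nonneg a
  have := norm_nonneg z
  constructor <;> nlinarith

lemma aux_geom (ζ : ℝ) (hζ : 1/2 < ζ) (a η z : ℂ) (ha : ‖a‖ < 1) (hη : ‖η‖ = 1)
    (hz : z ∈ ntReg ζ η) :
    0 < ‖z - η‖ ∧ ‖z - η‖ / ζ ≤ 1 - ‖z‖^2 ∧ 1 - ‖z‖^2 ≤ 2 * ‖z - η‖ ∧
    ‖1 - conj a * η‖ + ‖z - η‖ ≤ (1 + 4 * ζ) * ‖1 - conj a * z‖ := by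
  obtain ⟨hz1, hz2⟩ := hz
  have hz1 : ‖z‖ < 1 := by simpa using hz1
  have h0 := norm_nonneg z
  have hd : 1 - ‖z‖ ≤ ‖z - η‖ := by
    have := norm_sub_norm_le η z
    rw [hη, norm_sub_rev] at this; exact this
  have hp := (aux_pos a z ha hz1.le).1
  have hD : ‖1 - conj a * η‖ ≤ ‖1 - conj a * z‖ + ‖z - η‖ := by
    have e : 1 - conj a * η = (1 - conj a * z) + conj a * (z - η) := by ring
    rw [e]
    refine (norm_add_le _ _).trans ?_
    rw [norm_mul, RCLike.norm_conj]
    nlinarith [norm_nonneg (z - η)]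
  refine ⟨by linarith, ?_, by nlinarith, ?_⟩
  · rw [div_le_iff₀ (by linarith)]; linarith
  · have : ‖z - η‖ ≤ 2 * ζ * (1 - ‖z‖) := by
      have : ζ * (1 - ‖z‖^2) ≤ ζ * (2 * (1 - ‖z‖)) :=
        mul_le_mul_of_nonneg_left (by nlinarith) (by linarith)
      linarith
    have : 2 * ζ * (1 - ‖z‖) ≤ 2 * ζ * ‖1 - conj a * z‖ :=
      mul_le_mul_of_nonneg_left hp (by linarith)
    linarith

lemma aux_rpow_le (α l x u : ℝ) (hl : 0 < l) (h1 : l ≤ x) (h2 : x ≤ u) :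
    x ^ α ≤ l ^ α + u ^ α := by
  have hx : 0 < x := by linarith
  have hu : 0 < u := by linarith
  have := Real.rpow_pos_of_pos hl α
  have := Real.rpow_pos_of_pos hu α
  rcases le_total 0 α with h | h
  · have := Real.rpow_le_rpow hx.le h2 h
    linarith
  · have := Real.rpow_le_rpow_of_nonpos hl h1 h
    linarith

lemma aux_rpow_ge (α l x u : ℝ) (hl : 0 < l) (h1 : l ≤ x) (h2 : x ≤ u) :
    min (l ^ α) (u ^ α) ≤ x ^ α := by
  have hx : 0 < x := by linarith
  rcases le_total 0 α with h | h
  · exact (min_le_left _ _).trans (Real.rpow_le_rpow hl.le h1 h)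
  · exact (min_le_right _ _).trans (Real.rpow_le_rpow_of_nonpos hx h2 h)

/-- inner upper bound -/
lemma aux_inner (α m ζ : ℝ) (hα : -2 < α) (hm : α + 2 < m) (hζ : 1/2 < ζ) :
    ∃ C > 0, ∀ a η : ℂ, ‖a‖ < 1 → ‖η‖ = 1 → ∃ h : ℂ → ℝ, Integrable h ∧ (∀ z, 0 ≤ h z) ∧
      (∀ z ∈ ntReg ζ η, ‖1 - conj a * z‖ ^ (-m) * (1 - ‖z‖^2) ^ α ≤ h z) ∧
      ∫ z, h z ≤ C * ‖1 - conj a * η‖ ^ (α + 2 - m) := by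
  have hζ0 : 0 < ζ := by linarith
  set K : ℝ := (1 + 4 * ζ) ^ m * (ζ⁻¹ ^ α + 2 ^ α) with hK
  have hK0 : 0 < K := by positivity
  have hJ : 0 ≤ ∫ u : ℂ, ‖u‖ ^ α * (1 + ‖u‖) ^ (-m) := integral_nonneg fun u => by positivity
  refine ⟨K * ((∫ u : ℂ, ‖u‖ ^ α * (1 + ‖u‖) ^ (-m)) + 1), by positivity, ?_⟩
  intro a η ha hη
  have hD : 0 < ‖1 - conj a * η‖ := by
    have := (aux_pos a η ha hη.le).2
    linarith
  obtain ⟨h1, h2⟩ := aux_scale2 α m hα hm _ hD η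
  refine ⟨fun z => K * (‖z - η‖ ^ α * (‖1 - conj a * η‖ + ‖z - η‖) ^ (-m)), h1.const_mul K,
    fun z => by positivity, ?_, ?_⟩
  · intro z hz
    obtain ⟨g0, g1, g2, g3⟩ := aux_geom ζ hζ a η z ha hη hz
    have b1 : (1 - ‖z‖^2) ^ α ≤ (ζ⁻¹ ^ α + 2 ^ α) * ‖z - η‖ ^ α := by
      have := aux_rpow_le α _ _ _ (div_pos g0 hζ0) g1 g2
      rw [div_eq_inv_mul, Real.mul_rpow (by positivity) g0.le,
        Real.mul_rpow (by positivity) g0.le] at this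
      linarith
    have b2 : ‖1 - conj a * z‖ ^ (-m) ≤
        (1 + 4 * ζ) ^ m * (‖1 - conj a * η‖ + ‖z - η‖) ^ (-m) := by
      have hs : 0 < ‖1 - conj a * η‖ + ‖z - η‖ := by positivity
      have : (‖1 - conj a * η‖ + ‖z - η‖) / (1 + 4 * ζ) ≤ ‖1 - conj a * z‖ := by
        rw [div_le_iff₀ (by positivity)]; linarith
      have := Real.rpow_le_rpow_of_nonpos (z := -m) (by positivity) this (by linarith)
      rw [Real.div_rpow (by positivity) (by positivity), Real.rpow_neg (x := 1 + 4*ζ)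
        (by positivity), div_inv_eq_mul] at this
      linarith
    have hz1 : ‖z‖ < 1 := by simpa using hz.1
    have hz2 : 0 ≤ 1 - ‖z‖^2 := le_trans (by positivity) g1
    calc _ ≤ ((1 + 4 * ζ) ^ m * (‖1 - conj a * η‖ + ‖z - η‖) ^ (-m)) *
          ((ζ⁻¹ ^ α + 2 ^ α) * ‖z - η‖ ^ α) :=
        mul_le_mul b2 b1 (by positivity) (by positivity)
      _ = _ := by rw [hK]; ring
  · rw [integral_const_mul, h2]
    have : 0 < ‖1 - conj a * η‖ ^ (α + 2 - m) := by positivity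
    nlinarith [mul_pos hK0 this]

lemma aux_D (a : ℂ) (θ : ℝ) : ‖1 - conj a * Complex.exp (θ * Complex.I)‖ =
    ‖Complex.exp (θ * Complex.I) - a‖ := by
  have e : 1 - conj a * Complex.exp (θ * Complex.I) =
      Complex.exp (θ * Complex.I) * conj (Complex.exp (θ * Complex.I) - a) := by
    rw [map_sub, mul_sub, Complex.mul_conj, Complex.normSq_eq_norm_sq,
      Complex.norm_exp_ofReal_mul_I]
    simp; ring
  rw [e, norm_mul, RCLike.norm_conj, Complex.norm_exp_ofReal_mul_I, one_mul]

lemma aux_rot (θ φ : ℝ) : ‖Complex.exp (θ * Complex.I) - Complex.exp (φ * Complex.I)‖ =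
    |2 * Real.sin ((θ - φ) / 2)| := by
  have := Complex.norm_exp_I_mul_ofReal_sub_one (θ - φ)
  rw [Real.norm_eq_abs] at this
  rw [← this]
  have e : Complex.exp (θ * Complex.I) - Complex.exp (φ * Complex.I) =
    Complex.exp (φ * Complex.I) * (Complex.exp (Complex.I * ((θ - φ : ℝ) : ℂ)) - 1) := by
    rw [mul_sub, ← Complex.exp_add, mul_one]
    congr 2
    push_cast; ring
  rw [e, norm_mul, Complex.norm_exp_ofReal_mul_I, one_mul]

lemma aux_arg (a : ℂ) (ha : ‖a‖ < 1) : ‖Complex.exp (a.arg * Complex.I) - a‖ = 1 - ‖a‖ := by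
  have : Complex.exp (a.arg * Complex.I) - a = ((1 - ‖a‖ : ℝ) : ℂ) * Complex.exp (a.arg * Complex.I) := by
    conv_lhs => rw [← Complex.norm_mul_exp_arg_mul_I a]
    simp
    rw [sub_mul, one_mul, Complex.norm_mul_exp_arg_mul_I]
  rw [this, norm_mul, Complex.norm_exp_ofReal_mul_I, Complex.norm_real,
    Real.norm_of_nonneg (by linarith), mul_one]

lemma aux_D_lower (a : ℂ) (ha : ‖a‖ < 1) (θ : ℝ) (hθ : |θ - a.arg| ≤ Real.pi) :
    (1 - ‖a‖) + |θ - a.arg| ≤ (1 + 2 * Real.pi) * ‖1 - conj a * Complex.exp (θ * Complex.I)‖ := by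
  have h1 := (aux_pos a (Complex.exp (θ * Complex.I)) ha (Complex.norm_exp_ofReal_mul_I θ).le).2
  rw [aux_D] at *
  have h2 := aux_rot θ a.arg
  have h3 := aux_arg a ha
  have h4 : ‖Complex.exp (θ * Complex.I) - Complex.exp (a.arg * Complex.I)‖ ≤
      ‖Complex.exp (θ * Complex.I) - a‖ + ‖Complex.exp (a.arg * Complex.I) - a‖ := by
    rw [norm_sub_rev (Complex.exp (a.arg * Complex.I))]
    exact norm_sub_le_norm_sub_add_norm_sub _ _ _
  have h5 : 2 / Real.pi * |θ - a.arg| ≤ |2 * Real.sin ((θ - a.arg) / 2)| := by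
    rw [abs_mul, Real.abs_sin_eq_sin_abs_of_abs_le_pi, abs_div]
    · have := Real.mul_le_sin (x := |θ - a.arg| / 2) (by positivity) (by linarith)
      simp only [abs_two]
      linarith
    · rw [abs_div, abs_two]; linarith [Real.pi_pos]
  have h6 : |θ - a.arg| ≤ Real.pi * ‖Complex.exp (θ * Complex.I) - a‖ := by
    have : 2 / Real.pi * |θ - a.arg| ≤ 2 * ‖Complex.exp (θ * Complex.I) - a‖ := by linarith
    rw [div_mul_eq_mul_div, div_le_iff₀ Real.pi_pos] at this
    linarith
  nlinarith [Real.pi_pos, norm_nonneg (Complex.exp (θ * Complex.I) - a)]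

lemma aux_D_upper (a : ℂ) (ha : ‖a‖ < 1) (θ : ℝ) :
    ‖1 - conj a * Complex.exp (θ * Complex.I)‖ ≤ (1 - ‖a‖) + |θ - a.arg| := by
  rw [aux_D]
  have h2 := aux_rot θ a.arg
  have h3 := aux_arg a ha
  have h4 := norm_sub_le_norm_sub_add_norm_sub (Complex.exp (θ * Complex.I))
    (Complex.exp (a.arg * Complex.I)) a
  have h5 : |2 * Real.sin ((θ - a.arg) / 2)| ≤ |θ - a.arg| := by
    rw [abs_mul, abs_two]
    have := Real.abs_sin_le_abs (x := (θ - a.arg) / 2)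
    rw [abs_div, abs_two] at this
    linarith
  linarith

lemma aux_meas (ζ : ℝ) (η : ℂ) : MeasurableSet (ntReg ζ η) := by
  have : ntReg ζ η = Metric.ball (0:ℂ) 1 ∩ {z | ‖z - η‖ < ζ * (1 - ‖z‖^2)} := rfl
  rw [this]
  exact measurableSet_ball.inter (measurableSet_lt (by fun_prop) (by fun_prop))

lemma aux_A (a : ℂ) (ha : ‖a‖ < 1) : 0 < 1 - ‖a‖ ∧ 1 - ‖a‖ ≤ 1 - ‖a‖^2 ∧
    1 - ‖a‖^2 ≤ 2 * (1 - ‖a‖) := by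
  have := norm_nonneg a
  refine ⟨by linarith, by nlinarith, by nlinarith⟩

lemma aux_upper (p q α m ζ : ℝ) (hp : 0 < p) (hq : 0 < q) (hα : -2 < α) (hζ : 1/2 < ζ)
    (hm : α + 2 + p / q < m) :
    ∃ C > 0, ∀ a : ℂ, ‖a‖ < 1 → ∀ M ≥ 0, ∀ g : ℂ → ℝ, (∀ z, ‖z‖ < 1 → 0 ≤ g z) →
      (∀ z, ‖z‖ < 1 → g z ≤ M * ((1 - ‖a‖^2) ^ (m - α - 2 - p/q) *
        (‖1 - conj a * z‖ ^ (-m) * (1 - ‖z‖^2) ^ α))) →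
      (∫ θ in (0:ℝ)..(2*Real.pi),
        (∫ z in ntReg ζ (Complex.exp (θ * Complex.I)), g z) ^ (q/p)) ^ (1/q) ≤ M ^ (1/p) * C := by
  have hpq : 0 < p / q := by positivity
  have hqp : 0 < q / p := by positivity
  obtain ⟨C0, hC0, hin⟩ := aux_inner α m ζ hα (by linarith) hζ
  set k : ℝ := (m - α - 2) * (q / p) with hk
  have hk1 : 1 < k := by
    have : p / q < m - α - 2 := by linarith
    have := mul_lt_mul_of_pos_right this hqp
    have e : p / q * (q / p) = 1 := by field_simp
    linarith
  set J : ℝ := ∫ x : ℝ, (1 + |x|) ^ (-k) with hJ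
  have hJ0 : 0 ≤ J := integral_nonneg fun x => by positivity
  set C1 : ℝ := C0 ^ (q/p) * (1 + 2 * Real.pi) ^ k * 2 ^ (k - 1) * (J + 1) with hC1
  have hpi := Real.pi_pos
  have hC1pos : 0 < C1 := by positivity
  refine ⟨C1 ^ (1/q), by positivity, ?_⟩
  intro a ha M hM g hg0 hg
  obtain ⟨ht, hA1, hA2⟩ := aux_A a ha
  set t := 1 - ‖a‖ with htdef
  set A := 1 - ‖a‖^2 with hAdef
  have hA : 0 < A := by linarith
  set e : ℝ := m - α - 2 - p/q with he
  set I : ℝ → ℝ := fun θ => ∫ z in ntReg ζ (Complex.exp (θ * Complex.I)), g z with hI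
  have hI0 : ∀ θ, 0 ≤ I θ := fun θ => setIntegral_nonneg (aux_meas _ _) fun z hz =>
    hg0 z (by simpa using hz.1)
  have hIu : ∀ θ, I θ ≤ M * A ^ e * C0 *
      ‖1 - conj a * Complex.exp (θ * Complex.I)‖ ^ (α + 2 - m) := by
    intro θ
    obtain ⟨h, h1, h2, h3, h4⟩ := hin a _ ha (Complex.norm_exp_ofReal_mul_I θ)
    calc I θ ≤ ∫ z in ntReg ζ (Complex.exp (θ * Complex.I)), M * A ^ e * h z := by
          apply integral_mono_of_nonneg
          · exact (ae_restrict_iff' (aux_meas _ _)).2 (Filter.Eventually.of_forall fun z hz =>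
              hg0 z (by simpa using hz.1))
          · exact (h1.const_mul _).integrableOn
          · refine (ae_restrict_iff' (aux_meas _ _)).2 (Filter.Eventually.of_forall fun z hz => ?_)
            refine (hg z (by simpa using hz.1)).trans ?_
            rw [← mul_assoc]
            exact mul_le_mul_of_nonneg_left (h3 z hz) (by positivity)
      _ ≤ ∫ z, M * A ^ e * h z := setIntegral_le_integral (h1.const_mul _)
          (Filter.Eventually.of_forall fun z => mul_nonneg (by positivity) (h2 z))
      _ ≤ _ := by
          rw [integral_const_mul, mul_assoc (M * A ^ e)]
          exact mul_le_mul_of_nonneg_left h4 (by positivity)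
  have hper : Function.Periodic (fun θ => I θ ^ (q/p)) (2 * Real.pi) := by
    intro θ
    simp only [hI]
    have : Complex.exp (((θ + 2 * Real.pi : ℝ) : ℂ) * Complex.I) =
        Complex.exp (θ * Complex.I) := by
      push_cast
      rw [add_mul, Complex.exp_periodic]
    rw [this]
  have hshift : ∫ θ in (0:ℝ)..(2*Real.pi), I θ ^ (q/p) =
      ∫ θ in (a.arg - Real.pi)..(a.arg - Real.pi + 2*Real.pi), I θ ^ (q/p) := by
    have := hper.intervalIntegral_add_eq 0 (a.arg - Real.pi)
    rwa [zero_add] at this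
  obtain ⟨s1, s2⟩ := aux_scale1 k hk1 t ht a.arg
  have hmain : ∫ θ in (0:ℝ)..(2*Real.pi), I θ ^ (q/p) ≤ M ^ (q/p) * C1 := by
    rw [hshift, intervalIntegral.integral_of_le (by linarith)]
    set B : ℝ := (M * A ^ e * C0) ^ (q/p) * (1 + 2 * Real.pi) ^ k with hB
    have hB0 : 0 ≤ B := by positivity
    calc _ ≤ ∫ θ in Set.Ioc (a.arg - Real.pi) (a.arg - Real.pi + 2*Real.pi),
          B * (t + |θ - a.arg|) ^ (-k) := by
          apply integral_mono_of_nonneg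
          · exact Filter.Eventually.of_forall fun θ => Real.rpow_nonneg (hI0 θ) _
          · exact (s1.const_mul _).integrableOn
          · refine (ae_restrict_iff' measurableSet_Ioc).2 (Filter.Eventually.of_forall fun θ hθ => ?_)
            have hθ' : |θ - a.arg| ≤ Real.pi := abs_le.2 ⟨by linarith [hθ.1], by linarith [hθ.2]⟩
            have hl := aux_D_lower a ha θ hθ'
            set D := ‖1 - conj a * Complex.exp (θ * Complex.I)‖ with hD
            have hDpos : 0 < D := by
              have := (aux_pos a (Complex.exp (θ * Complex.I)) ha
                (Complex.norm_exp_ofReal_mul_I θ).le).2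
              linarith
            have q1 : I θ ^ (q/p) ≤ (M * A ^ e * C0) ^ (q/p) * D ^ (-k) := by
              refine (Real.rpow_le_rpow (hI0 θ) (hIu θ) hqp.le).trans ?_
              rw [Real.mul_rpow (by positivity) (by positivity), ← Real.rpow_mul hDpos.le]
              apply le_of_eq
              congr 2
              rw [hk]; ring
            have q2 : D ^ (-k) ≤ (1 + 2 * Real.pi) ^ k * (t + |θ - a.arg|) ^ (-k) := by
              have hs : 0 < t + |θ - a.arg| := by positivity
              have : (t + |θ - a.arg|) / (1 + 2 * Real.pi) ≤ D := by
                rw [div_le_iff₀ (by positivity)]; linarith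
              have := Real.rpow_le_rpow_of_nonpos (z := -k) (by positivity) this (by linarith)
              rw [Real.div_rpow (by positivity) (by positivity),
                Real.rpow_neg (x := 1 + 2 * Real.pi) (by positivity), div_inv_eq_mul] at this
              linarith
            refine q1.trans ?_
            show _ ≤ (M * A ^ e * C0) ^ (q/p) * (1 + 2 * Real.pi) ^ k * (t + |θ - a.arg|) ^ (-k)
            rw [mul_assoc ((M * A ^ e * C0) ^ (q/p))]
            have q3 : 0 ≤ (M * A ^ e * C0) ^ (q/p) := by positivity
            exact mul_le_mul_of_nonneg_left q2 q3
      _ ≤ ∫ θ, B * (t + |θ - a.arg|) ^ (-k) := setIntegral_le_integral (s1.const_mul _)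
          (Filter.Eventually.of_forall fun z => by
            show 0 ≤ B * (t + |z - a.arg|) ^ (-k)
            positivity)
      _ = B * (t ^ (1 - k) * J) := by rw [integral_const_mul, s2]
      _ ≤ _ := by
        have r1 : (A ^ e) ^ (q/p) ≤ 2 ^ (k-1) * t ^ (k - 1) := by
          rw [← Real.rpow_mul hA.le, ← Real.mul_rpow (by norm_num) ht.le]
          have : e * (q/p) = k - 1 := by rw [he, hk]; field_simp
          rw [this]
          exact Real.rpow_le_rpow hA.le hA2 (by linarith)
        have r2 : t ^ (k-1) * t ^ (1-k) = 1 := by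
          rw [← Real.rpow_add ht]; simp
        rw [hB, Real.mul_rpow (by positivity) hC0.le, Real.mul_rpow hM (by positivity)]
        calc _ = M ^ (q/p) * (C0 ^ (q/p) * (1 + 2 * Real.pi) ^ k * ((A ^ e) ^ (q/p) * t ^ (1-k)) * J) := by
              ring
          _ ≤ M ^ (q/p) * (C0 ^ (q/p) * (1 + 2 * Real.pi) ^ k * (2 ^ (k - 1)) * (J + 1)) := by
              have r3 : (A ^ e) ^ (q/p) * t ^ (1-k) ≤ 2 ^ (k-1) := by
                calc _ ≤ 2 ^ (k-1) * t ^ (k - 1) * t ^ (1-k) :=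
                      mul_le_mul_of_nonneg_right r1 (by positivity)
                  _ = _ := by rw [mul_assoc, r2, mul_one]
              gcongr
              linarith
          _ = _ := by rw [hC1]
  have h0 : 0 ≤ ∫ θ in (0:ℝ)..(2*Real.pi), I θ ^ (q/p) :=
    intervalIntegral.integral_nonneg (by positivity) fun θ _ => Real.rpow_nonneg (hI0 θ) _
  refine (Real.rpow_le_rpow h0 hmain (by positivity)).trans ?_
  rw [Real.mul_rpow (by positivity) hC1pos.le, ← Real.rpow_mul hM]
  apply le_of_eq
  congr 2
  field_simp

lemma aux_kappa (ζ : ℝ) (hζ : 1/2 < ζ) : ∃ κ : ℝ, 0 < κ ∧ κ < 1/2 ∧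
    1 + κ < ζ * ((1 - κ) * (2 - κ * (1 + κ))) := by
  have hc : Continuous fun κ : ℝ => ζ * ((1 - κ) * (2 - κ * (1 + κ))) - (1 + κ) := by fun_prop
  have h0 : 0 < (fun κ : ℝ => ζ * ((1 - κ) * (2 - κ * (1 + κ))) - (1 + κ)) 0 := by
    norm_num; linarith
  have h1 := (hc.tendsto 0).eventually (lt_mem_nhds h0)
  obtain ⟨δ, hδ, h⟩ := Metric.eventually_nhds_iff.1 h1
  refine ⟨min (δ/2) (1/4), by positivity, lt_of_le_of_lt (min_le_right _ _) (by norm_num), ?_⟩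
  have := h (y := min (δ/2) (1/4)) (by
    rw [Real.dist_eq, sub_zero, abs_of_pos (by positivity)]
    exact lt_of_le_of_lt (min_le_left _ _) (by linarith))
  linarith

lemma aux_ball (ζ κ t : ℝ) (hζ : 1/2 < ζ) (hκ : 0 < κ) (hκ2 : κ < 1/2)
    (hκ3 : 1 + κ < ζ * ((1 - κ) * (2 - κ * (1 + κ)))) (ht : 0 < t) (ht1 : t ≤ 1) (η z : ℂ)
    (hη : ‖η‖ = 1) (hz : z ∈ Metric.ball (((1 - κ * t : ℝ) : ℂ) * η) (κ^2 * t)) :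
    z ∈ ntReg ζ η ∧ ‖z - η‖ ≤ κ * (1 + κ) * t ∧ κ * (1 - κ) * t ≤ 1 - ‖z‖^2 ∧
      1 - ‖z‖^2 ≤ 2 * κ * (1 + κ) * t := by
  rw [mem_ball, dist_eq_norm] at hz
  set w := ((1 - κ * t : ℝ) : ℂ) * η with hw
  have hkt : 0 < κ * t := by positivity
  have hkt1 : κ * t < 1 := by nlinarith
  have hwn : ‖w‖ = 1 - κ * t := by
    rw [hw, norm_mul, hη, Complex.norm_real, Real.norm_of_nonneg (by linarith), mul_one]
  have hwe : ‖w - η‖ = κ * t := by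
    have : w - η = ((- (κ * t) : ℝ) : ℂ) * η := by rw [hw]; push_cast; ring
    rw [this, norm_mul, hη, Complex.norm_real, norm_neg, Real.norm_of_nonneg hkt.le, mul_one]
  have h1 : ‖z - η‖ ≤ κ * (1 + κ) * t := by
    have := norm_sub_le_norm_sub_add_norm_sub z w η
    nlinarith
  have h2 : κ * (1 - κ) * t ≤ 1 - ‖z‖ := by
    have := norm_sub_norm_le z w
    nlinarith
  have h3 : 1 - ‖z‖ ≤ κ * (1 + κ) * t := by
    have := norm_sub_norm_le η z
    rw [hη, norm_sub_rev] at this; linarith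
  have h4 : 0 < 1 - ‖z‖ := lt_of_lt_of_le (by
    have : 0 < 1 - κ := by linarith
    positivity) h2
  have h0 := norm_nonneg z
  refine ⟨⟨by simpa using (by linarith : ‖z‖ < 1), ?_⟩, h1, by nlinarith, by nlinarith⟩
  have h5 : 2 - κ * (1 + κ) ≤ 1 + ‖z‖ := by
    have : κ * (1 + κ) * t ≤ κ * (1 + κ) * 1 := mul_le_mul_of_nonneg_left ht1 (by positivity)
    linarith
  have h6 : 0 < 2 - κ * (1 + κ) := by nlinarith
  calc ‖z - η‖ ≤ κ * t * (1 + κ) := by linarith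
    _ < κ * t * (ζ * ((1 - κ) * (2 - κ * (1 + κ)))) := mul_lt_mul_of_pos_left hκ3 hkt
    _ = ζ * ((κ * (1 - κ) * t) * (2 - κ * (1 + κ))) := by ring
    _ ≤ ζ * ((1 - ‖z‖) * (1 + ‖z‖)) := by
      apply mul_le_mul_of_nonneg_left _ (by linarith)
      exact mul_le_mul h2 h5 h6.le h4.le
    _ = _ := by ring

lemma aux_lower (p q α m ζ : ℝ) (hp : 0 < p) (hq : 0 < q) (hα : -2 < α) (hζ : 1/2 < ζ)
    (hm : α + 2 + p / q < m) :
    ∃ C > 0, ∀ a : ℂ, ‖a‖ < 1 →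
      C ≤ (∫ θ in (0:ℝ)..(2*Real.pi),
        (∫ z in ntReg ζ (Complex.exp (θ * Complex.I)), (1 - ‖a‖^2) ^ (m - α - 2 - p/q) *
        (‖1 - conj a * z‖ ^ (-m) * (1 - ‖z‖^2) ^ α)) ^ (q/p)) ^ (1/q) := by
  have hpq : 0 < p / q := by positivity
  have hqp : 0 < q / p := by positivity
  have hpi := Real.pi_pos
  obtain ⟨C0, hC0, hin⟩ := aux_inner α m ζ hα (by linarith) hζ
  obtain ⟨κ, hκ, hκ2, hκ3⟩ := aux_kappa ζ hζ
  have hκ4 : 0 < 1 - κ := by linarith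
  set μ : ℝ := min ((κ * (1 - κ)) ^ α) ((2 * κ * (1 + κ)) ^ α) with hμ
  have hμ0 : 0 < μ := lt_min (by positivity) (by positivity)
  set c3 : ℝ := 4 ^ (-m) * μ * (κ^2)^2 * Real.pi with hc3
  have hc30 : 0 < c3 := by positivity
  refine ⟨(c3 ^ (q/p)) ^ (1/q), by positivity, ?_⟩
  intro a ha
  obtain ⟨ht, hA1, hA2⟩ := aux_A a ha
  have ht1 : 1 - ‖a‖ ≤ 1 := by linarith [norm_nonneg a]
  set t := 1 - ‖a‖ with htdef
  set A := 1 - ‖a‖^2 with hAdef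
  have hA : 0 < A := by linarith
  set e : ℝ := m - α - 2 - p/q with he
  have he0 : 0 < e := by rw [he]; linarith
  set g : ℂ → ℝ := fun z => A ^ e * (‖1 - conj a * z‖ ^ (-m) * (1 - ‖z‖^2) ^ α) with hg
  have hgm : Measurable g := by
    have : Measurable fun z : ℂ => ‖1 - conj a * z‖ := by fun_prop
    rw [hg]; fun_prop
  have hg0 : ∀ z, ‖z‖ < 1 → 0 ≤ g z := by
    intro z hz
    have : 0 ≤ 1 - ‖z‖^2 := by nlinarith [norm_nonneg z]
    simp only [hg]; positivity
  set I : ℝ → ℝ := fun θ => ∫ z in ntReg ζ (Complex.exp (θ * Complex.I)), g z with hI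
  have hI0 : ∀ θ, 0 ≤ I θ := fun θ => setIntegral_nonneg (aux_meas _ _) fun z hz =>
    hg0 z (by simpa using hz.1)
  have hII : ∀ θ : ℝ, IntegrableOn g (ntReg ζ (Complex.exp (θ * Complex.I))) ∧
      I θ ≤ A ^ e * (C0 * t ^ (α + 2 - m)) := by
    intro θ
    obtain ⟨h, h1, h2, h3, h4⟩ := hin a _ ha (Complex.norm_exp_ofReal_mul_I θ)
    have hle : ∀ z ∈ ntReg ζ (Complex.exp (θ * Complex.I)), g z ≤ A ^ e * h z := fun z hz =>
      mul_le_mul_of_nonneg_left (h3 z hz) (by positivity)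
    have hint : IntegrableOn g (ntReg ζ (Complex.exp (θ * Complex.I))) := by
      refine Integrable.mono' (h1.const_mul (A ^ e)).integrableOn hgm.aestronglyMeasurable ?_
      refine (ae_restrict_iff' (aux_meas _ _)).2 (Filter.Eventually.of_forall fun z hz => ?_)
      rw [Real.norm_of_nonneg (hg0 z (by simpa using hz.1))]
      exact hle z hz
    refine ⟨hint, ?_⟩
    calc I θ ≤ ∫ z in ntReg ζ (Complex.exp (θ * Complex.I)), A ^ e * h z :=
          setIntegral_mono_on hint (h1.const_mul _).integrableOn (aux_meas _ _) hle
      _ ≤ ∫ z, A ^ e * h z := setIntegral_le_integral (h1.const_mul _)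
          (Filter.Eventually.of_forall fun z => mul_nonneg (by positivity) (h2 z))
      _ ≤ _ := by
          rw [integral_const_mul]
          refine mul_le_mul_of_nonneg_left (h4.trans ?_) (by positivity)
          refine mul_le_mul_of_nonneg_left ?_ hC0.le
          exact Real.rpow_le_rpow_of_nonpos ht (aux_pos a _ ha
            (Complex.norm_exp_ofReal_mul_I θ).le).2 (by linarith)
  have hImeas : Measurable I := by
    have hS : MeasurableSet {x : ℝ × ℂ | x.2 ∈ ntReg ζ (Complex.exp (x.1 * Complex.I))} := by
      have : {x : ℝ × ℂ | x.2 ∈ ntReg ζ (Complex.exp (x.1 * Complex.I))} =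
        {x : ℝ × ℂ | x.2 ∈ Metric.ball (0:ℂ) 1} ∩
        {x : ℝ × ℂ | ‖x.2 - Complex.exp (x.1 * Complex.I)‖ < ζ * (1 - ‖x.2‖^2)} := rfl
      rw [this]
      refine (measurable_snd measurableSet_ball).inter (measurableSet_lt ?_ ?_)
      · exact Continuous.measurable (by fun_prop)
      · exact Continuous.measurable (by fun_prop)
    have hsm : StronglyMeasurable (Function.uncurry fun (θ : ℝ) (z : ℂ) =>
        (ntReg ζ (Complex.exp (θ * Complex.I))).indicator g z) := by
      have : (Function.uncurry fun (θ : ℝ) (z : ℂ) =>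
        (ntReg ζ (Complex.exp (θ * Complex.I))).indicator g z) =
        {x : ℝ × ℂ | x.2 ∈ ntReg ζ (Complex.exp (x.1 * Complex.I))}.indicator
          (fun x => g x.2) := by
        ext ⟨θ, z⟩
        simp [Function.uncurry, Set.indicator]
      rw [this]
      exact ((hgm.comp measurable_snd).indicator hS).stronglyMeasurable
    have := (hsm.integral_prod_right (ν := (volume : Measure ℂ))).measurable
    have e2 : I = fun θ : ℝ => ∫ z, (ntReg ζ (Complex.exp (θ * Complex.I))).indicator g z := by
      ext θ
      simp only [hI]
      rw [integral_indicator (aux_meas _ _)]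
    rw [e2]; exact this
  have hper : Function.Periodic (fun θ => I θ ^ (q/p)) (2 * Real.pi) := by
    intro θ
    simp only [hI]
    have : Complex.exp (((θ + 2 * Real.pi : ℝ) : ℂ) * Complex.I) =
        Complex.exp (θ * Complex.I) := by
      push_cast
      rw [add_mul, Complex.exp_periodic]
    rw [this]
  have hshift : ∫ θ in (0:ℝ)..(2*Real.pi), I θ ^ (q/p) =
      ∫ θ in a.arg..(a.arg + 2*Real.pi), I θ ^ (q/p) := by
    have := hper.intervalIntegral_add_eq 0 a.arg
    rwa [zero_add] at this
  have hFint : IntegrableOn (fun θ => I θ ^ (q/p)) (Set.Ioc a.arg (a.arg + 2*Real.pi)) := by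
    refine Measure.integrableOn_of_bounded (M := (A ^ e * (C0 * t ^ (α + 2 - m))) ^ (q/p)) ?_
      (hImeas.pow_const _).aestronglyMeasurable ?_
    · exact measure_Ioc_lt_top.ne
    · refine Filter.Eventually.of_forall fun θ => ?_
      rw [Real.norm_of_nonneg (Real.rpow_nonneg (hI0 θ) _)]
      exact Real.rpow_le_rpow (hI0 θ) (hII θ).2 hqp.le
  have hIlow : ∀ θ ∈ Set.Ioc a.arg (a.arg + t), c3 * t ^ (-(p/q)) ≤ I θ := by
    intro θ hθ
    set η := Complex.exp (θ * Complex.I) with hη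
    have hηn : ‖η‖ = 1 := Complex.norm_exp_ofReal_mul_I θ
    set b := Metric.ball (((1 - κ * t : ℝ) : ℂ) * η) (κ^2 * t) with hb
    have hbs : ∀ z ∈ b, _ := fun z hz => aux_ball ζ κ t hζ hκ hκ2 hκ3 ht ht1 η z hηn hz
    have hsub : b ⊆ ntReg ζ η := fun z hz => (hbs z hz).1
    have h1 : ∫ z in b, g z ≤ I θ := by
      refine setIntegral_mono_set (hII θ).1 ?_ hsub.eventuallyLE
      exact (ae_restrict_iff' (aux_meas _ _)).2 (Filter.Eventually.of_forall fun z hz =>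
        hg0 z (by simpa using hz.1))
    have h2 : ∀ z ∈ b, t ^ e * ((4 * t) ^ (-m) * (μ * t ^ α)) ≤ g z := by
      intro z hz
      obtain ⟨k1, k2, k3, k4⟩ := hbs z hz
      have hz1 : ‖z‖ < 1 := by simpa using k1.1
      have u1 : t ^ e ≤ A ^ e := Real.rpow_le_rpow ht.le hA1 he0.le
      have u2 : μ * t ^ α ≤ (1 - ‖z‖^2) ^ α := by
        have := aux_rpow_ge α _ _ _ (by positivity) k3 k4
        rw [Real.mul_rpow (by positivity) ht.le, Real.mul_rpow (by positivity) ht.le,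
          ← min_mul_of_nonneg _ _ (by positivity)] at this
        exact this
      have u3 : ‖1 - conj a * z‖ ≤ 4 * t := by
        have hD := aux_D_upper a ha θ
        rw [abs_of_pos (by linarith [hθ.1] : 0 < θ - a.arg)] at hD
        have e1 : 1 - conj a * z = (1 - conj a * η) - conj a * (z - η) := by ring
        have : ‖1 - conj a * z‖ ≤ ‖1 - conj a * η‖ + ‖z - η‖ := by
          rw [e1]
          refine (norm_sub_le _ _).trans ?_
          rw [norm_mul, RCLike.norm_conj]
          nlinarith [norm_nonneg (z - η)]
        have : κ * (1 + κ) * t ≤ 1 * t := mul_le_mul_of_nonneg_right (by nlinarith) ht.le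
        linarith [hθ.2]
      have u4 : 0 < ‖1 - conj a * z‖ := by
        have := (aux_pos a z ha hz1.le).2
        linarith
      have u5 : (4 * t) ^ (-m) ≤ ‖1 - conj a * z‖ ^ (-m) :=
        Real.rpow_le_rpow_of_nonpos u4 u3 (by linarith)
      simp only [hg]
      gcongr
    have h3 := setIntegral_ge_of_const_le_real (μ := (volume : Measure ℂ)) (s := b)
      measurableSet_ball measure_ball_lt_top.ne h2 ((hII θ).1.mono_set hsub)
    have h4 : (volume : Measure ℂ).real b = (κ^2 * t)^2 * Real.pi := by
      rw [measureReal_def, hb, Complex.volume_ball, ENNReal.toReal_mul, ENNReal.toReal_pow,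
        ENNReal.toReal_ofReal (by positivity)]
      simp
    refine le_trans (le_of_eq ?_) (h3.trans h1)
    have e3 : -(p/q) = e + (-m) + α + (2:ℕ) := by rw [he]; push_cast; ring
    rw [h4, hc3, e3, Real.rpow_add ht, Real.rpow_add ht, Real.rpow_add ht, Real.rpow_natCast,
      Real.mul_rpow (by norm_num) ht.le]
    ring
  refine Real.rpow_le_rpow (by positivity) ?_ (by positivity)
  show c3 ^ (q/p) ≤ ∫ θ in (0:ℝ)..(2*Real.pi), I θ ^ (q/p)
  rw [hshift, intervalIntegral.integral_of_le (by linarith)]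
  have hsub : Set.Ioc a.arg (a.arg + t) ⊆ Set.Ioc a.arg (a.arg + 2 * Real.pi) :=
    Set.Ioc_subset_Ioc_right (by linarith [Real.pi_gt_three])
  have h1 : ∫ θ in Set.Ioc a.arg (a.arg + t), I θ ^ (q/p) ≤
      ∫ θ in Set.Ioc a.arg (a.arg + 2 * Real.pi), I θ ^ (q/p) :=
    setIntegral_mono_set hFint (Filter.Eventually.of_forall fun θ => Real.rpow_nonneg (hI0 θ) _)
      hsub.eventuallyLE
  have h2 := setIntegral_ge_of_const_le_real (μ := (volume : Measure ℝ))
    (s := Set.Ioc a.arg (a.arg + t)) (f := fun θ => I θ ^ (q/p)) (c := c3 ^ (q/p) * t⁻¹)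
    measurableSet_Ioc (by simp) (by
      intro θ hθ
      have := Real.rpow_le_rpow (by positivity) (hIlow θ hθ) hqp.le
      rw [Real.mul_rpow hc30.le (by positivity), ← Real.rpow_mul ht.le,
        show -(p/q) * (q/p) = -1 by field_simp, Real.rpow_neg_one] at this
      exact this) (hFint.mono_set hsub)
  have h3 : (volume : Measure ℝ).real (Set.Ioc a.arg (a.arg + t)) = t := by
    rw [Real.volume_real_Ioc_of_le (by linarith)]; ring
  rw [h3, mul_assoc, inv_mul_cancel₀ ht.ne', mul_one] at h2
  exact h2.trans h1

lemma aux_norm (p q α gam : ℝ) (hp : 0 < p) (a z : ℂ) (ha : ‖a‖ < 1) :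
    ‖(((1 - ‖a‖^2) ^ (gam - (α+2)/p - 1/q) : ℝ) : ℂ) / ((1:ℂ) - conj a * z) ^ (gam : ℂ)‖ ^ p
      = (1 - ‖a‖^2) ^ (gam * p - α - 2 - p/q) * ‖1 - conj a * z‖ ^ (-(gam * p)) := by
  obtain ⟨ht, hA1, -⟩ := aux_A a ha
  have hA : 0 < 1 - ‖a‖^2 := by linarith
  rw [norm_div, Complex.norm_cpow_real, Complex.norm_real,
    Real.norm_of_nonneg (by positivity), Real.div_rpow (by positivity) (by positivity),
    ← Real.rpow_mul hA.le, ← Real.rpow_mul (norm_nonneg _), Real.rpow_neg (norm_nonneg _),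
    div_eq_mul_inv]
  congr 2
  field_simp
  ring

lemma aux_pd (a z : ℂ) (ha : ‖a‖ < 1) (hz : ‖z‖ < 1) (ρ : ℝ) (hρ : 0 < ρ)
    (h : z ∉ pDisk a ρ) :
    (1 - ‖a‖^2) * (1 - ‖z‖^2) ≤ (1 - ρ^2) * ‖1 - conj a * z‖^2 := by
  have hpos : 0 < ‖1 - conj a * z‖ := by
    have := (aux_pos a z ha hz.le).2
    linarith
  have h1 : ρ ≤ ‖(a - z) / (1 - conj a * z)‖ := by
    by_contra hc
    exact h ⟨by simpa using hz, not_le.1 hc⟩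
  rw [norm_div, le_div_iff₀ hpos] at h1
  have id1 : ‖1 - conj a * z‖^2 - ‖a - z‖^2 = (1 - ‖a‖^2) * (1 - ‖z‖^2) := by
    simp only [← Complex.normSq_eq_norm_sq, Complex.normSq_apply]
    simp
    ring
  nlinarith [pow_le_pow_left₀ (by positivity) h1 2]

theorem stmt11 (p q α ζ lam gam : ℝ) (hp : 0 < p) (hq : 0 < q) (hα : -2 < α)
    (hζ : 1/2 < ζ) (hlam : max 1 (p/q) < lam)
    (hgam : max ((α+2)/p + 1/q) ((lam + 2*α + 4)/p) < gam) :
    ∃ C' > 0, ∃ C'' > 0, ∀ ε > 0, ∃ ρ ∈ Set.Ioo (0:ℝ) 1,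
      ∀ a ∈ Metric.ball (0:ℂ) 1,
        C'' ≤ tnorm p q α ζ
            (fun z => (((1 - ‖a‖^2) ^ (gam - (α+2)/p - 1/q) : ℝ) : ℂ) /
              ((1:ℂ) - conj a * z) ^ (gam : ℂ)) ∧
        tnorm p q α ζ
            (fun z => (((1 - ‖a‖^2) ^ (gam - (α+2)/p - 1/q) : ℝ) : ℂ) /
              ((1:ℂ) - conj a * z) ^ (gam : ℂ)) ≤ C' ∧
        tnorm p q α ζ
            (Set.indicator (Metric.ball (0:ℂ) 1 \ pDisk a ρ)
              (fun z => (((1 - ‖a‖^2) ^ (gam - (α+2)/p - 1/q) : ℝ) : ℂ) /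
                ((1:ℂ) - conj a * z) ^ (gam : ℂ))) ≤ ε := by
  have hpq : 0 < p / q := by positivity
  set m := gam * p with hmdef
  have hm : α + 2 + p/q < m := by
    have := mul_lt_mul_of_pos_right ((le_max_left _ _).trans_lt hgam) hp
    have e : ((α+2)/p + 1/q) * p = α + 2 + p / q := by field_simp
    rw [e] at this; exact this
  -- small loss exponent
  obtain ⟨s, hs, hs1, hs2⟩ : ∃ s : ℝ, 0 < s ∧ s < α + 2 ∧ s < m - (α + 2 + p/q) := by
    refine ⟨min (α + 2) (m - (α + 2 + p/q)) / 2, ?_, ?_, ?_⟩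
    · have : 0 < min (α + 2) (m - (α + 2 + p/q)) := lt_min (by linarith) (by linarith)
      linarith
    · have := min_le_left (α + 2) (m - (α + 2 + p/q))
      linarith
    · have : 0 < min (α + 2) (m - (α + 2 + p/q)) := lt_min (by linarith) (by linarith)
      have := min_le_right (α + 2) (m - (α + 2 + p/q))
      linarith
  obtain ⟨C1, hC1, hup⟩ := aux_upper p q α m ζ hp hq hα hζ hm
  obtain ⟨C2, hC2, hup2⟩ := aux_upper p q (α - s) (m - 2 * s) ζ hp hq (by linarith) hζ
    (by linarith)
  obtain ⟨C3, hC3, hlow⟩ := aux_lower p q α m ζ hp hq hα hζ hm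
  refine ⟨C1, hC1, C3, hC3, ?_⟩
  intro ε hε
  -- choose the radius
  obtain ⟨δ, hδ0, hδ1, hδ⟩ : ∃ δ : ℝ, 0 < δ ∧ δ < 1 ∧ (δ ^ s) ^ (1/p) * C2 ≤ ε := by
    refine ⟨min ((ε / C2) ^ (p/s)) (1/2), by positivity,
      lt_of_le_of_lt (min_le_right _ _) (by norm_num), ?_⟩
    have h1 : (min ((ε / C2) ^ (p/s)) (1/2)) ^ (s * (1/p)) ≤ ε / C2 := by
      have := Real.rpow_le_rpow (z := s * (1/p)) (by positivity)
        (min_le_left ((ε / C2) ^ (p/s)) (1/2)) (by positivity)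
      refine this.trans (le_of_eq ?_)
      rw [← Real.rpow_mul (by positivity), show p/s * (s * (1/p)) = 1 by field_simp,
        Real.rpow_one]
    rw [← Real.rpow_mul (by positivity)]
    rwa [le_div_iff₀ hC2] at h1
  have hρ2 : Real.sqrt (1 - δ) ^ 2 = 1 - δ := Real.sq_sqrt (by linarith)
  have hρ0 : 0 < Real.sqrt (1 - δ) := Real.sqrt_pos.2 (by linarith)
  refine ⟨Real.sqrt (1 - δ), ⟨hρ0, ?_⟩, ?_⟩
  · rw [Real.sqrt_lt' one_pos]; linarith
  intro a ha
  have ha : ‖a‖ < 1 := by simpa using ha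
  obtain ⟨ht, hA1, -⟩ := aux_A a ha
  have hA : 0 < 1 - ‖a‖^2 := by linarith
  have hB : ∀ z : ℂ, ‖z‖ < 1 → 0 < 1 - ‖z‖^2 := by
    intro z hz
    nlinarith [norm_nonneg z]
  refine ⟨?_, ?_, ?_⟩
  · have := hlow a ha
    unfold tnorm
    simp_rw [aux_norm p q α gam hp a _ ha, mul_assoc]
    exact this
  · unfold tnorm
    have := hup a ha 1 zero_le_one (fun z => ‖(((1 - ‖a‖^2) ^ (gam - (α+2)/p - 1/q) : ℝ) : ℂ) /
      ((1:ℂ) - conj a * z) ^ (gam : ℂ)‖ ^ p * (1 - ‖z‖^2) ^ α) (fun z hz => by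
        have := hB z hz
        positivity) (fun z hz => by
        rw [aux_norm p q α gam hp a _ ha, mul_assoc, one_mul])
    rwa [Real.one_rpow, one_mul] at this
  · unfold tnorm
    refine (hup2 a ha (δ ^ s) (by positivity) _ (fun z hz => ?_) (fun z hz => ?_)).trans hδ
    · have := hB z hz
      positivity
    · have hBz := hB z hz
      have hw : 0 < ‖1 - conj a * z‖ := by
        have := (aux_pos a z ha hz.le).2
        linarith
      by_cases hmem : z ∈ Metric.ball (0:ℂ) 1 \ pDisk a (Real.sqrt (1 - δ))
      · rw [Set.indicator_of_mem hmem, aux_norm p q α gam hp a _ ha]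
        have hk := aux_pd a z ha hz _ hρ0 hmem.2
        rw [hρ2, sub_sub_cancel] at hk
        have hk2 := Real.rpow_le_rpow (by positivity) hk hs.le
        rw [Real.mul_rpow hA.le hBz.le, Real.mul_rpow hδ0.le (by positivity),
          ← Real.rpow_natCast ‖1 - conj a * z‖, ← Real.rpow_mul (norm_nonneg (1 - conj a * z))] at hk2
        rw [show m - 2 * s - (α - s) - 2 - p/q = (m - α - 2 - p/q) + (-s) by ring,
          show -(m - 2 * s) = -m + ((2:ℕ):ℝ) * s by push_cast; ring,
          show α - s = α + (-s) by ring, Real.rpow_add hA, Real.rpow_add hw, Real.rpow_add hBz,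
          Real.rpow_neg hA.le s, Real.rpow_neg hBz.le s]
        have hAs : 0 < (1 - ‖a‖^2) ^ s := by positivity
        have hBs : 0 < (1 - ‖z‖^2) ^ s := by positivity
        set X := (1 - ‖a‖^2) ^ s
        set Y := (1 - ‖z‖^2) ^ s
        set W := ‖1 - conj a * z‖ ^ (((2:ℕ):ℝ) * s)
        have hX : 1 ≤ δ ^ s * W * (X⁻¹ * Y⁻¹) := by
          rw [← mul_inv, ← div_eq_mul_inv, le_div_iff₀ (by positivity), one_mul]
          exact hk2
        calc _ = ((1 - ‖a‖^2) ^ (m - α - 2 - p/q) * ‖1 - conj a * z‖ ^ (-m) * (1 - ‖z‖^2) ^ α) * 1 := by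
              rw [mul_one]
          _ ≤ ((1 - ‖a‖^2) ^ (m - α - 2 - p/q) * ‖1 - conj a * z‖ ^ (-m) * (1 - ‖z‖^2) ^ α) *
              (δ ^ s * W * (X⁻¹ * Y⁻¹)) := mul_le_mul_of_nonneg_left hX (by positivity)
          _ = _ := by ring
      · rw [Set.indicator_of_notMem hmem, norm_zero, Real.zero_rpow hp.ne', zero_mul]
        positivity
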